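/- Theorem 1 (natural decay without Fourier analysis): Assume (A,B) satisfies the Kalman rank condition. Then there exists a constant C > 0, depending only on n, A, B, κ (and not on the initial datum or time), such that every classical solution U of the linear partially dissipative system with initial datum U₀ = U(·,0) satisfies, for all t > 0, ‖U₂(t)‖_{L²} + ‖∂ₓU(t)‖_{L²} ≤ C(1+t)^{−1/2}‖U₀‖_{H¹}. -/

import Mathlib

open MeasureTheory Matrix Finset

noncomputable section

/-- Index type for the block decomposition `ℝⁿ = ℝ^{n₁} × ℝ^{n₂}`. -/
abbrev Idx (n₁ n₂ : ℕ) := Fin n₁ ⊕ Fin n₂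

/-- The partially dissipative matrix `B = [[0,0],[0,D]]`. -/
def Bmat {n₁ n₂ : ℕ} (D : Matrix (Fin n₂) (Fin n₂) ℝ) :
    Matrix (Idx n₁ n₂) (Idx n₁ n₂) ℝ :=
  Matrix.fromBlocks 0 0 0 D

/-- The Kalman rank condition for the pair `(A,B)`: the only `y ∈ ℝⁿ` with
`B A^k y = 0` for all `k = 0,…,n−1` is `y = 0`. -/
def KalmanCondition {n₁ n₂ : ℕ} (A B : Matrix (Idx n₁ n₂) (Idx n₁ n₂) ℝ) : Prop :=
  ∀ y : Idx n₁ n₂ → ℝ, (∀ k < n₁ + n₂, (B * A ^ k).mulVec y = 0) → y = 0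

/-- Spatial derivative `∂ₓU(t,x)` (time is the first argument). -/
def pdx {E : Type*} [NormedAddCommGroup E] [NormedSpace ℝ E]
    (U : ℝ → ℝ → E) (t x : ℝ) : E :=
  deriv (fun y => U t y) x

/-- A classical solution of `∂ₜU + A ∂ₓU = −BU` on `ℝ × [0,∞)`:
a smooth function that is Schwartz in `x`, locally uniformly in `t ≥ 0`,
and solves the equation for `t ≥ 0`. -/
structure IsClassicalSolution {n₁ n₂ : ℕ} (A : Matrix (Idx n₁ n₂) (Idx n₁ n₂) ℝ)
    (D : Matrix (Fin n₂) (Fin n₂) ℝ) (U : ℝ → ℝ → Idx n₁ n₂ → ℝ) : Prop where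
  smooth : ContDiff ℝ (⊤ : ℕ∞) (fun p : ℝ × ℝ => U p.1 p.2)
  decay : ∀ (k m : ℕ) (T : ℝ), ∃ C : ℝ, ∀ t ∈ Set.Icc (0 : ℝ) T, ∀ x : ℝ,
      |x| ^ k * ‖iteratedDeriv m (fun y => U t y) x‖ ≤ C
  eqn : ∀ (t x : ℝ), 0 ≤ t →
      deriv (fun s => U s x) t + A.mulVec (pdx U t x) + (Bmat D).mulVec (U t x) = 0

/-- Squared `L²` norm of a vector-valued function on `ℝ`. -/
def sqL2 {ι : Type*} [Fintype ι] (f : ℝ → ι → ℝ) : ℝ := ∫ x, ∑ i, (f x i) ^ 2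

/-- Squared `H¹` norm. -/
def sqH1 {ι : Type*} [Fintype ι] (f : ℝ → ι → ℝ) : ℝ := sqL2 f + sqL2 (deriv f)

/-- Squared weighted `L²` norm `‖|x|^μ f‖²_{L²}`. -/
def wSqL2 {ι : Type*} [Fintype ι] (μ : ℝ) (f : ℝ → ι → ℝ) : ℝ :=
  ∫ x, |x| ^ (2 * μ) * ∑ i, (f x i) ^ 2

/-- The dissipated component `U₂(t)`. -/
def U2part {n₁ n₂ : ℕ} (U : ℝ → ℝ → Idx n₁ n₂ → ℝ) (t : ℝ) : ℝ → Fin n₂ → ℝ :=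
  fun x j => U t x (Sum.inr j)

theorem dotProduct_self_nonneg_real {ι : Type*} [Fintype ι] (u : ι → ℝ) : 0 ≤ u ⬝ᵥ u :=
  sum_nonneg fun i _ => mul_self_nonneg (u i)

theorem exists_skew_diagonal {ι κ : Type*} [Fintype ι] [Fintype κ]
    (l : ι → ℝ) (G : Matrix κ ι ℝ)
    (hG : ∀ (z : ι → ℝ) (μ : ℝ), (∀ i, l i ≠ μ → z i = 0) → G *ᵥ z = 0 → z = 0) :
    ∃ K : Matrix ι ι ℝ, Kᵀ = -K ∧ ∀ z : ι → ℝ, z ≠ 0 →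
      0 < (G *ᵥ z) ⬝ᵥ (G *ᵥ z) + 2 * (z ⬝ᵥ (K *ᵥ (l * z))) := by
  classical
  set S : Matrix ι ι ℝ := Gᵀ * G with hS
  have hSsymm : ∀ i j, S i j = S j i := fun i j => by
    simp [hS, Matrix.mul_apply, mul_comm]
  have hGS : ∀ z : ι → ℝ, (G *ᵥ z) ⬝ᵥ (G *ᵥ z) = ∑ i, ∑ j, S i j * (z i * z j) := fun z => by
    rw [dotProduct_mulVec, vecMul_mulVec, ← dotProduct_mulVec]
    simp only [dotProduct, mulVec, Finset.mul_sum, ← hS]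
    exact sum_congr rfl fun i _ => sum_congr rfl fun j _ => by ring
  refine ⟨Matrix.of fun i j => S i j / (l i - l j), ?_, fun z hz => ?_⟩
  · ext i j
    simp only [transpose_apply, of_apply]
    rw [hSsymm j i, ← neg_sub (l i) (l j), div_neg]
    rfl
  set part : ℝ → ι → ℝ := fun μ i => if l i = μ then z i else 0 with hpart
  have hsum : (G *ᵥ z) ⬝ᵥ (G *ᵥ z) +
      2 * (z ⬝ᵥ ((Matrix.of fun i j => S i j / (l i - l j)) *ᵥ (l * z))) =
      ∑ μ ∈ univ.image l, (G *ᵥ part μ) ⬝ᵥ (G *ᵥ part μ) := by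
    have h1 : z ⬝ᵥ ((Matrix.of fun i j => S i j / (l i - l j)) *ᵥ (l * z)) =
        ∑ i, ∑ j, S i j / (l i - l j) * l j * (z i * z j) := by
      simp only [dotProduct, mulVec, Finset.mul_sum, of_apply, Pi.mul_apply]
      exact sum_congr rfl fun i _ => sum_congr rfl fun j _ => by ring
    have h2 : ∑ i, ∑ j, S i j / (l i - l j) * l j * (z i * z j) =
        ∑ i, ∑ j, -(S i j / (l i - l j) * l i * (z i * z j)) := by
      rw [sum_comm]
      refine sum_congr rfl fun i _ => sum_congr rfl fun j _ => ?_
      rw [hSsymm j i, ← neg_sub (l i) (l j), div_neg]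
      ring
    have h3 : ∀ μ, (G *ᵥ part μ) ⬝ᵥ (G *ᵥ part μ) =
        ∑ i, ∑ j, if l i = μ then (if l j = l i then S i j * (z i * z j) else 0) else 0 := by
      intro μ
      rw [hGS]
      refine sum_congr rfl fun i _ => sum_congr rfl fun j _ => ?_
      by_cases hi : l i = μ
      · subst hi; simp [hpart]
      · simp [hpart, hi]
    rw [two_mul, hGS, h1]
    nth_rewrite 2 [h2]
    simp_rw [h3]
    rw [sum_comm (s := univ.image l), ← sum_add_distrib, ← sum_add_distrib]
    refine sum_congr rfl fun i _ => ?_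
    rw [sum_comm (s := univ.image l), ← sum_add_distrib, ← sum_add_distrib]
    refine sum_congr rfl fun j _ => ?_
    rw [sum_ite_eq, if_pos (mem_image_of_mem l (mem_univ i))]
    by_cases hij : l j = l i
    · simp [hij]
    · have : l i - l j ≠ 0 := sub_ne_zero.2 (Ne.symm hij)
      rw [if_neg hij]; field_simp; ring
  rw [hsum]
  refine lt_of_le_of_ne (sum_nonneg fun μ _ => dotProduct_self_nonneg_real _) fun h0 => hz ?_
  have h0' := (sum_eq_zero_iff_of_nonneg fun μ _ => dotProduct_self_nonneg_real _).1 h0.symm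
  ext i
  have := hG (part (l i)) (l i) (fun j hj => by simp [hpart, hj])
    (dotProduct_self_eq_zero.1 (h0' _ (mem_image_of_mem l (mem_univ i))))
  simpa [hpart] using congrFun this i

/-- A Kawashima compensating matrix: a skew `K` such that `BᵀB + KA - AK` is positive definite. -/
theorem exists_skew_compensator {ι : Type*} [Fintype ι] [DecidableEq ι]
    (A B : Matrix ι ι ℝ) (hA : A.IsSymm)
    (hAB : ∀ (v : ι → ℝ) (μ : ℝ), A *ᵥ v = μ • v → B *ᵥ v = 0 → v = 0) :
    ∃ K : Matrix ι ι ℝ, Kᵀ = -K ∧ ∀ y : ι → ℝ, y ≠ 0 →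
      0 < (B *ᵥ y) ⬝ᵥ (B *ᵥ y) + 2 * (y ⬝ᵥ (K *ᵥ (A *ᵥ y))) := by
  have hH : A.IsHermitian := by rwa [Matrix.IsHermitian, conjTranspose_eq_transpose_of_trivial]
  set O : Matrix ι ι ℝ := (hH.eigenvectorUnitary : Matrix ι ι ℝ) with hO
  have hO1 : O * Oᵀ = 1 := by
    simpa [star_eq_conjTranspose] using Unitary.coe_mul_star_self hH.eigenvectorUnitary
  have hO2 : Oᵀ * O = 1 := by
    simpa [star_eq_conjTranspose] using Unitary.coe_star_mul_self hH.eigenvectorUnitary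
  have hsp : A = O * diagonal hH.eigenvalues * Oᵀ := by
    conv_lhs => rw [hH.spectral_theorem]
    simp [Unitary.conjStarAlgAut_apply, star_eq_conjTranspose, hO]
  set l := hH.eigenvalues
  have hdiag : ∀ z : ι → ℝ, diagonal l *ᵥ z = l * z := fun z => by
    ext i; simp [mulVec_diagonal]
  have hAO : ∀ z : ι → ℝ, A *ᵥ (O *ᵥ z) = O *ᵥ (l * z) := fun z => by
    rw [mulVec_mulVec, ← hdiag, mulVec_mulVec, hsp, mul_assoc, hO2, mul_one]
  have hOz : ∀ z : ι → ℝ, Oᵀ *ᵥ (O *ᵥ z) = z := fun z => by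
    rw [mulVec_mulVec, hO2, one_mulVec]
  obtain ⟨K, hKs, hK⟩ := exists_skew_diagonal l (B * O) fun z μ hz hBz => by
    have h := hAB (O *ᵥ z) μ (by
      rw [hAO, ← mulVec_smul]
      congr 1
      ext i
      by_cases h : l i = μ
      · simp [h]
      · simp [hz i h]) (by rw [mulVec_mulVec, hBz])
    rw [← hOz z, h, mulVec_zero]
  refine ⟨O * K * Oᵀ, by simp [transpose_mul, hKs, mul_assoc], fun y hy => ?_⟩
  have hy' : O *ᵥ (Oᵀ *ᵥ y) = y := by rw [mulVec_mulVec, hO1, one_mulVec]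
  have := hK (Oᵀ *ᵥ y) fun h => hy (by rw [← hy', h, mulVec_zero])
  generalize Oᵀ *ᵥ y = z at this hy'
  subst hy'
  have e : (O * K * Oᵀ) *ᵥ (A *ᵥ (O *ᵥ z)) = O *ᵥ (K *ᵥ (l * z)) := by
    rw [hAO, ← mulVec_mulVec, hOz, mulVec_mulVec]
  rwa [e, dotProduct_mulVec (O *ᵥ z), vecMul_mulVec, hO2, vecMul_one, mulVec_mulVec]

theorem exists_mulVec_dotProduct_self_le {ι κ : Type*} [Fintype ι] [Fintype κ]
    (M : Matrix κ ι ℝ) :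
    ∃ C : ℝ, 0 < C ∧ ∀ u : ι → ℝ, (M *ᵥ u) ⬝ᵥ (M *ᵥ u) ≤ C * (u ⬝ᵥ u) := by
  have h0 : 0 ≤ ∑ i, ∑ j, M i j ^ 2 := by positivity
  refine ⟨∑ i, ∑ j, M i j ^ 2 + 1, by positivity, fun u => ?_⟩
  have h : (M *ᵥ u) ⬝ᵥ (M *ᵥ u) ≤ (∑ i, ∑ j, M i j ^ 2) * (u ⬝ᵥ u) := by
    rw [Finset.sum_mul]
    refine sum_le_sum fun i _ => ?_
    simpa [mulVec, dotProduct, sq] using sum_mul_sq_le_sq_mul_sq univ (M i) u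
  linarith [dotProduct_self_nonneg_real u]

theorem two_mul_dotProduct_le {ι : Type*} [Fintype ι] (u v : ι → ℝ) {a : ℝ} (ha : 0 < a) :
    2 * (u ⬝ᵥ v) ≤ a⁻¹ * (u ⬝ᵥ u) + a * (v ⬝ᵥ v) := by
  have h := dotProduct_self_nonneg_real (u - a • v)
  simp only [sub_dotProduct, dotProduct_sub, smul_dotProduct, dotProduct_smul, smul_eq_mul,
    dotProduct_comm v u] at h
  have h2 : a⁻¹ * (u ⬝ᵥ u) + a * (v ⬝ᵥ v) - 2 * (u ⬝ᵥ v) =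
    a⁻¹ * (u ⬝ᵥ u - a * (u ⬝ᵥ v) - a * (u ⬝ᵥ v - a * (v ⬝ᵥ v))) := by field_simp; ring
  have h3 := mul_nonneg (inv_pos.2 ha).le (h.trans_eq (by ring :
    _ = u ⬝ᵥ u - a * (u ⬝ᵥ v) - a * (u ⬝ᵥ v - a * (v ⬝ᵥ v))))
  linarith

theorem exists_pos_mul_dotProduct_self_le {ι : Type*} [Fintype ι] (q : (ι → ℝ) → ℝ)
    (hq : Continuous q) (hsmul : ∀ (a : ℝ) y, q (a • y) = a ^ 2 * q y)
    (hpos : ∀ y, y ≠ 0 → 0 < q y) :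
    ∃ c : ℝ, 0 < c ∧ ∀ y, c * (y ⬝ᵥ y) ≤ q y := by
  obtain hne | hne := (Metric.sphere (0 : ι → ℝ) 1).eq_empty_or_nonempty
  · have hz : ∀ y : ι → ℝ, y = 0 := fun y => by
      by_contra hy
      have : ‖y‖⁻¹ • y ∈ Metric.sphere (0 : ι → ℝ) 1 := by
        simp [norm_smul, inv_mul_cancel₀ (norm_ne_zero_iff.2 hy)]
      simp [hne] at this
    refine ⟨1, one_pos, fun y => ?_⟩
    have := hsmul 0 0
    rw [hz y]
    simp at this ⊢
    exact this.ge
  obtain ⟨y₀, hy₀, hmin⟩ := (isCompact_sphere (0 : ι → ℝ) 1).exists_isMinOn hne hq.continuousOn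
  have hm : 0 < q y₀ := hpos y₀ fun h => by simp [h] at hy₀
  refine ⟨q y₀ / (Fintype.card ι + 1), by positivity, fun y => ?_⟩
  have h1 : q y₀ * ‖y‖ ^ 2 ≤ q y := by
    by_cases hy : y = 0
    · have := hsmul 0 0
      simp at this
      simp [hy, this]
    have hn := norm_ne_zero_iff.2 hy
    have : ‖y‖⁻¹ • y ∈ Metric.sphere (0 : ι → ℝ) 1 := by
      simp [norm_smul, inv_mul_cancel₀ hn]
    have h := hmin this
    simp only [Set.mem_ofPred_eq, hsmul] at h
    calc q y₀ * ‖y‖ ^ 2 ≤ ‖y‖⁻¹ ^ 2 * q y * ‖y‖ ^ 2 := by gcongr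
      _ = q y := by field_simp
  have h2 : y ⬝ᵥ y ≤ (Fintype.card ι + 1) * ‖y‖ ^ 2 := by
    have : y ⬝ᵥ y ≤ ∑ _i : ι, ‖y‖ ^ 2 := sum_le_sum fun i _ => by
      rw [← sq, ← sq_abs, ← Real.norm_eq_abs]
      gcongr
      exact norm_le_pi_norm y i
    simp at this
    nlinarith [sq_nonneg ‖y‖]
  calc q y₀ / (Fintype.card ι + 1) * (y ⬝ᵥ y)
      ≤ q y₀ / (Fintype.card ι + 1) * ((Fintype.card ι + 1) * ‖y‖ ^ 2) := by gcongr
    _ = q y₀ * ‖y‖ ^ 2 := by field_simp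
    _ ≤ q y := h1

theorem exists_lyapunov_corrector {ι : Type*} [Fintype ι] [DecidableEq ι]
    (A B : Matrix ι ι ℝ) (hA : A.IsSymm)
    (hAB : ∀ (v : ι → ℝ) (μ : ℝ), A *ᵥ v = μ • v → B *ᵥ v = 0 → v = 0)
    {b : ℝ} (hb : 0 < b) (hB : ∀ u, b * ((B *ᵥ u) ⬝ᵥ (B *ᵥ u)) ≤ u ⬝ᵥ (B *ᵥ u)) :
    ∃ (K : Matrix ι ι ℝ) (c : ℝ), Kᵀ = -K ∧ 0 < c ∧
      (∀ u v, |v ⬝ᵥ (K *ᵥ u)| ≤ (u ⬝ᵥ u + v ⬝ᵥ v) / 2) ∧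
      ∀ u v, -2 * (u ⬝ᵥ (B *ᵥ u)) - 2 * (v ⬝ᵥ (B *ᵥ v))
        - 2 * (v ⬝ᵥ (K *ᵥ (A *ᵥ v + B *ᵥ u))) ≤ -c * (v ⬝ᵥ v) := by
  obtain ⟨K, hKs, hK⟩ := exists_skew_compensator A B hA hAB
  obtain ⟨c, hc, hcK⟩ := exists_pos_mul_dotProduct_self_le
    (fun y => (B *ᵥ y) ⬝ᵥ (B *ᵥ y) + 2 * (y ⬝ᵥ (K *ᵥ (A *ᵥ y)))) (by fun_prop)
    (fun a y => by simp [mulVec_smul]; ring) hK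
  obtain ⟨k, hk, hkK⟩ := exists_mulVec_dotProduct_self_le K
  obtain ⟨ε, hε, hε1, hε2, hε3⟩ : ∃ ε : ℝ, 0 < ε ∧ ε ^ 2 * k ≤ 1 ∧ ε ≤ 2 * b ∧
      ε * ((c / 2)⁻¹ * k) ≤ 2 * b := by
    refine ⟨min (min 1 (1 / k)) (min (2 * b) (2 * b / ((c / 2)⁻¹ * k))), by positivity,
      ?_, ?_, ?_⟩
    · set ε := min (min 1 (1 / k)) (min (2 * b) (2 * b / ((c / 2)⁻¹ * k)))
      have h0 : 0 < ε := by positivity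
      have h1 : ε ≤ 1 := (min_le_left _ _).trans (min_le_left _ _)
      have h2 : ε ≤ 1 / k := (min_le_left _ _).trans (min_le_right _ _)
      rw [le_div_iff₀ hk] at h2
      nlinarith
    · exact (min_le_right _ _).trans (min_le_left _ _)
    · rw [← le_div_iff₀ (by positivity)]
      exact (min_le_right _ _).trans (min_le_right _ _)
  refine ⟨ε • K, ε * c / 2, by simp [hKs], by positivity, fun u v => ?_, fun u v => ?_⟩
  · have h1 := two_mul_dotProduct_le v (ε • (K *ᵥ u)) one_pos
    have h2 := two_mul_dotProduct_le v (-ε • (K *ᵥ u)) one_pos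
    have h3 : ε ^ 2 * ((K *ᵥ u) ⬝ᵥ (K *ᵥ u)) ≤ u ⬝ᵥ u :=
      calc ε ^ 2 * ((K *ᵥ u) ⬝ᵥ (K *ᵥ u)) ≤ ε ^ 2 * (k * (u ⬝ᵥ u)) := by gcongr; exact hkK u
        _ = (ε ^ 2 * k) * (u ⬝ᵥ u) := by ring
        _ ≤ 1 * (u ⬝ᵥ u) := by gcongr; exact dotProduct_self_nonneg_real u
        _ = _ := one_mul _
    simp only [dotProduct_smul, smul_dotProduct, smul_eq_mul, inv_one, one_mul] at h1 h2
    rw [abs_le, smul_mulVec, dotProduct_smul, smul_eq_mul]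
    constructor <;> nlinarith
  · have h1 := hcK v
    have h2 := two_mul_dotProduct_le (-(K *ᵥ (B *ᵥ u))) v (half_pos hc)
    rw [neg_dotProduct, neg_dotProduct, dotProduct_neg, neg_neg,
      dotProduct_comm _ v] at h2
    have h3 := hkK (B *ᵥ u)
    have hu := hB u
    have hv := hB v
    have hBu := dotProduct_self_nonneg_real (B *ᵥ u)
    have hBv := dotProduct_self_nonneg_real (B *ᵥ v)
    rw [smul_mulVec, dotProduct_smul, smul_eq_mul, mulVec_add, dotProduct_add]
    have e1 := mul_le_mul_of_nonneg_left h1 hε.le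
    have e2 := mul_le_mul_of_nonneg_left h2 hε.le
    have e3 := mul_le_mul_of_nonneg_left h3 (by positivity : 0 ≤ ε * (c / 2)⁻¹)
    have e4 := mul_le_mul_of_nonneg_right hε2 hBv
    have e5 := mul_le_mul_of_nonneg_right hε3 hBu
    generalize (c / 2)⁻¹ = d at *
    generalize v ⬝ᵥ K *ᵥ A *ᵥ v = p1 at *
    generalize v ⬝ᵥ K *ᵥ B *ᵥ u = p2 at *
    nlinarith

theorem HasDerivAt.dotProduct {ι : Type*} [Fintype ι] {f g : ℝ → ι → ℝ} {f' g' : ι → ℝ} {x : ℝ}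
    (hf : HasDerivAt f f' x) (hg : HasDerivAt g g' x) :
    HasDerivAt (fun y => f y ⬝ᵥ g y) (f' ⬝ᵥ g x + f x ⬝ᵥ g') x := by
  simp only [_root_.dotProduct, ← sum_add_distrib]
  exact .fun_sum fun i _ => (hasDerivAt_pi.1 hf i).mul (hasDerivAt_pi.1 hg i)

theorem HasDerivAt.matrix_mulVec {ι κ : Type*} [Fintype ι] [Fintype κ] (M : Matrix κ ι ℝ)
    {f : ℝ → ι → ℝ} {f' : ι → ℝ} {x : ℝ} (hf : HasDerivAt f f' x) :
    HasDerivAt (fun y => M *ᵥ f y) (M *ᵥ f') x :=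
  hasDerivAt_pi.2 fun i => by
    simp only [mulVec, _root_.dotProduct]
    exact .fun_sum fun j _ => (hasDerivAt_pi.1 hf j).const_mul _

/-- A continuous function of `(t, x)` which is `O((1 + x²)⁻¹)` in `x`, locally uniformly in
`t ≥ 0`. -/
def QuadDecay (f : ℝ → ℝ → ℝ) : Prop :=
  Continuous (fun p : ℝ × ℝ => f p.1 p.2) ∧
    ∀ T : ℝ, ∃ C : ℝ, ∀ t ∈ Set.Icc (0 : ℝ) T, ∀ x, |f t x| ≤ C * (1 + x ^ 2)⁻¹

namespace QuadDecay

variable {f g : ℝ → ℝ → ℝ}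

theorem exists_nonneg_bound (hf : QuadDecay f) (T : ℝ) :
    ∃ C : ℝ, 0 ≤ C ∧ ∀ t ∈ Set.Icc (0 : ℝ) T, ∀ x, |f t x| ≤ C * (1 + x ^ 2)⁻¹ := by
  obtain ⟨C, hC⟩ := hf.2 T
  refine ⟨|C|, abs_nonneg C, fun t ht x => (hC t ht x).trans ?_⟩
  gcongr
  exact le_abs_self C

theorem zero : QuadDecay fun _ _ => 0 :=
  ⟨continuous_const, fun _ => ⟨0, by simp⟩⟩

theorem add (hf : QuadDecay f) (hg : QuadDecay g) : QuadDecay fun t x => f t x + g t x := by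
  refine ⟨hf.1.add hg.1, fun T => ?_⟩
  obtain ⟨C, hC⟩ := hf.2 T
  obtain ⟨C', hC'⟩ := hg.2 T
  refine ⟨C + C', fun t ht x => (abs_add_le _ _).trans ?_⟩
  rw [add_mul]
  exact add_le_add (hC t ht x) (hC' t ht x)

theorem mul (hf : QuadDecay f) (hg : QuadDecay g) : QuadDecay fun t x => f t x * g t x := by
  refine ⟨hf.1.mul hg.1, fun T => ?_⟩
  obtain ⟨C, h0, hC⟩ := hf.exists_nonneg_bound T
  obtain ⟨C', h0', hC'⟩ := hg.exists_nonneg_bound T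
  refine ⟨C * C', fun t ht x => ?_⟩
  rw [abs_mul]
  have h1 : (1 + x ^ 2)⁻¹ ≤ 1 := inv_le_one_of_one_le₀ (by nlinarith [sq_nonneg x])
  calc |f t x| * |g t x| ≤ (C * (1 + x ^ 2)⁻¹) * (C' * 1) := by
        gcongr
        · exact hC t ht x
        · exact (hC' t ht x).trans (by gcongr)
    _ = C * C' * (1 + x ^ 2)⁻¹ := by ring

theorem const_mul (hf : QuadDecay f) (a : ℝ) : QuadDecay fun t x => a * f t x := by
  refine ⟨hf.1.const_mul a, fun T => ?_⟩
  obtain ⟨C, hC⟩ := hf.2 T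
  refine ⟨|a| * C, fun t ht x => ?_⟩
  rw [abs_mul, mul_assoc]
  exact mul_le_mul_of_nonneg_left (hC t ht x) (abs_nonneg a)

theorem neg (hf : QuadDecay f) : QuadDecay fun t x => -f t x := by
  simpa using hf.const_mul (-1)

theorem sub (hf : QuadDecay f) (hg : QuadDecay g) : QuadDecay fun t x => f t x - g t x := by
  simpa [sub_eq_add_neg] using hf.add hg.neg

theorem sum {ι : Type*} (s : Finset ι) {f : ι → ℝ → ℝ → ℝ} (hf : ∀ i, QuadDecay (f i)) :
    QuadDecay fun t x => ∑ i ∈ s, f i t x := by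
  classical
  induction s using Finset.induction_on with
  | empty => simpa using zero
  | insert i s hi ih => simpa [sum_insert hi] using (hf i).add ih

theorem integrable (hf : QuadDecay f) {t : ℝ} (ht : 0 ≤ t) : Integrable (f t) := by
  obtain ⟨C, hC⟩ := hf.2 t
  refine (integrable_inv_one_add_sq.const_mul C).mono' ?_
    (.of_forall fun x => hC t ⟨ht, le_rfl⟩ x)
  exact (hf.1.comp (Continuous.prodMk_right t)).aestronglyMeasurable

theorem continuousOn_integral (hf : QuadDecay f) :
    ContinuousOn (fun t => ∫ x, f t x) (Set.Ici 0) := by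
  intro t ht
  obtain ⟨C, hC⟩ := hf.2 (t + 1)
  have h : ContinuousOn (fun t => ∫ x, f t x) (Set.Icc 0 (t + 1)) :=
    continuousOn_of_dominated
      (fun s _ => (hf.1.comp (Continuous.prodMk_right s)).aestronglyMeasurable)
      (fun s hs => .of_forall fun x => hC s hs x) (integrable_inv_one_add_sq.const_mul C)
      (.of_forall fun x => (hf.1.comp (Continuous.prodMk_left x)).continuousOn)
  refine (h t ⟨ht, by linarith⟩).mono_of_mem_nhdsWithin ?_
  rw [← Set.Ici_inter_Iic]
  exact Filter.inter_mem self_mem_nhdsWithin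
    (mem_nhdsWithin_of_mem_nhds (Iic_mem_nhds (by linarith)))

theorem hasDerivAt_integral (hf : QuadDecay f) (hg : QuadDecay g)
    (hfg : ∀ t x, 0 < t → HasDerivAt (fun s => f s x) (g t x) t) {t : ℝ} (ht : 0 < t) :
    HasDerivAt (fun s => ∫ x, f s x) (∫ x, g t x) t := by
  obtain ⟨C, hC⟩ := hg.2 (t + 1)
  refine (hasDerivAt_integral_of_dominated_loc_of_deriv_le (s := Set.Ioo 0 (t + 1))
    (bound := fun x => C * (1 + x ^ 2)⁻¹) (Ioo_mem_nhds ht (by linarith))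
    (.of_forall fun s => (hf.1.comp (Continuous.prodMk_right s)).aestronglyMeasurable)
    (hf.integrable ht.le) (hg.1.comp (Continuous.prodMk_right t)).aestronglyMeasurable
    (.of_forall fun x s hs => hC s ⟨hs.1.le, hs.2.le⟩ x)
    (integrable_inv_one_add_sq.const_mul C) (.of_forall fun x s hs => hfg s x hs.1)).2

/-- Energy estimate for a balance law `∂ₜe = ∂ₓh + (source)` with source at most `d`. -/
theorem exists_hasDerivAt_integral_le {e e' h h' d : ℝ → ℝ → ℝ} (he : QuadDecay e)
    (he' : QuadDecay e') (hh : QuadDecay h) (hh' : QuadDecay h') (hd : QuadDecay d)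
    (hee' : ∀ t x, 0 < t → HasDerivAt (fun s => e s x) (e' t x) t)
    (hhh' : ∀ t x, 0 < t → HasDerivAt (h t) (h' t x) x)
    (hle : ∀ t x, 0 < t → e' t x - h' t x ≤ d t x) {t : ℝ} (ht : 0 < t) :
    ∃ m ≤ ∫ x, d t x, HasDerivAt (fun s => ∫ x, e s x) m t := by
  refine ⟨_, ?_, he.hasDerivAt_integral he' hee' ht⟩
  have h0 : ∫ x, h' t x = 0 := integral_eq_zero_of_hasDerivAt_of_integrable
    (fun x => hhh' t x ht) (hh'.integrable ht.le) (hh.integrable ht.le)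
  calc ∫ x, e' t x = ∫ x, (e' t x - h' t x) := by
        rw [integral_sub (he'.integrable ht.le) (hh'.integrable ht.le), h0, sub_zero]
    _ ≤ ∫ x, d t x := MeasureTheory.integral_mono ((he'.sub hh').integrable ht.le)
        (hd.integrable ht.le) fun x => hle t x ht

theorem dotProduct {ι : Type*} [Fintype ι] {u v : ℝ → ℝ → ι → ℝ}
    (hu : ∀ i, QuadDecay fun t x => u t x i) (hv : ∀ i, QuadDecay fun t x => v t x i) :
    QuadDecay fun t x => u t x ⬝ᵥ v t x :=
  sum _ fun i => (hu i).mul (hv i)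

theorem mulVec {ι κ : Type*} [Fintype ι] (M : Matrix κ ι ℝ) {u : ℝ → ℝ → ι → ℝ}
    (hu : ∀ i, QuadDecay fun t x => u t x i) (k : κ) :
    QuadDecay fun t x => (M *ᵥ u t x) k :=
  sum _ fun i => (hu i).const_mul (M k i)

end QuadDecay

theorem antitoneOn_Ici_of_hasDerivAt {F : ℝ → ℝ} (hF : ContinuousOn F (Set.Ici 0))
    (h : ∀ t, 0 < t → ∃ m ≤ 0, HasDerivAt F m t) : AntitoneOn F (Set.Ici 0) := by
  refine antitoneOn_of_deriv_nonpos (convex_Ici 0) hF ?_ ?_ <;> rw [interior_Ici] <;>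
    intro t ht <;> obtain ⟨m, hm, hd⟩ := h t ht
  · exact hd.differentiableAt.differentiableWithinAt
  · rwa [hd.deriv]

/-- Time-weighted Lyapunov argument: `Φ` controls the energies, dissipates `E`, and `f` is damped
up to a forcing by `E`. -/
theorem decay_of_lyapunov {Φ E f : ℝ → ℝ} {c k a H : ℝ} (hc : 0 < c) (hk : 0 < k) (ha : 0 < a)
    (hΦc : ContinuousOn Φ (Set.Ici 0)) (hEc : ContinuousOn E (Set.Ici 0))
    (hfc : ContinuousOn f (Set.Ici 0))
    (hΦ0 : Φ 0 ≤ 2 * H) (hE0 : E 0 ≤ H) (hf0 : f 0 ≤ H)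
    (hEnn : ∀ t, 0 ≤ t → 0 ≤ E t) (hfnn : ∀ t, 0 ≤ t → 0 ≤ f t)
    (hΦ : ∀ t, 0 ≤ t → f t ≤ 2 * Φ t)
    (hΦd : ∀ t, 0 < t → ∃ m ≤ -c * E t, HasDerivAt Φ m t)
    (hEd : ∀ t, 0 < t → ∃ m ≤ 0, HasDerivAt E m t)
    (hfd : ∀ t, 0 < t → ∃ m ≤ -k * f t + a * E t, HasDerivAt f m t) {t : ℝ} (ht : 0 ≤ t) :
    (1 + t) * E t ≤ (1 + 2 / c) * H ∧
      (1 + t) * f t ≤ (1 + (4 + a * (1 + 2 / c)) / k) * H := by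
  have hΦnn : ∀ t, 0 ≤ t → 0 ≤ Φ t := fun t ht => by linarith [hΦ t ht, hfnn t ht]
  have hΦle : ∀ t, 0 ≤ t → Φ t ≤ 2 * H := fun t ht => by
    refine (antitoneOn_Ici_of_hasDerivAt hΦc (fun s hs => ?_) Set.self_mem_Ici ht ht).trans hΦ0
    obtain ⟨m, hm, hd⟩ := hΦd s hs
    exact ⟨m, by nlinarith [hEnn s hs.le], hd⟩
  have hE : ∀ t, 0 ≤ t → (1 + t) * E t ≤ (1 + 2 / c) * H := fun t ht => by
    have h1 : E t ≤ H :=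
      (antitoneOn_Ici_of_hasDerivAt hEc hEd Set.self_mem_Ici ht ht).trans hE0
    have h2 : Φ t + c * t * E t ≤ Φ 0 + c * 0 * E 0 := by
      refine antitoneOn_Ici_of_hasDerivAt (F := fun t => Φ t + c * t * E t)
        (by fun_prop) (fun s hs => ?_) Set.self_mem_Ici ht ht
      obtain ⟨m, hm, hd⟩ := hΦd s hs
      obtain ⟨m', hm', hd'⟩ := hEd s hs
      refine ⟨_, ?_, hd.add (((hasDerivAt_id s).const_mul c).mul hd')⟩
      have : c * s * m' ≤ 0 := mul_nonpos_of_nonneg_of_nonpos (by positivity) hm'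
      simp only [id]
      linarith
    have h3 : t * E t ≤ 2 / c * H := by
      rw [div_mul_eq_mul_div, le_div_iff₀ hc]
      linarith [hΦnn t ht]
    linarith
  refine ⟨hE t ht, ?_⟩
  set R := (4 + a * (1 + 2 / c)) / k * H with hR
  have hkR : k * R = 4 * H + a * ((1 + 2 / c) * H) := by rw [hR]; field_simp
  have hH : 0 ≤ H := (hEnn 0 le_rfl).trans hE0
  have hR0 : 0 ≤ R := by positivity
  have h := antitoneOn_Ici_of_hasDerivAt
    (F := fun t => Real.exp (k * t) * ((1 + t) * f t - R)) (by fun_prop) (fun s hs => by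
      obtain ⟨m, hm, hd⟩ := hfd s hs
      refine ⟨_, ?_, (((hasDerivAt_id s).const_mul k).exp).mul
        ((((hasDerivAt_id s).const_add 1).mul hd).sub_const R)⟩
      have h1 : (1 + s) * m ≤ (1 + s) * (-k * f s + a * E s) := by gcongr
      have h2 := mul_le_mul_of_nonneg_left (hE s hs.le) ha.le
      have h3 := hΦle s hs.le
      have h4 := hΦ s hs.le
      have h5 : k * ((1 + s) * f s - R) + (f s + (1 + s) * m) ≤ 0 := by
        rw [mul_sub, hkR]; nlinarith
      have := mul_nonpos_of_nonneg_of_nonpos (Real.exp_pos (k * s)).le h5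
      simp only [id]
      linarith) Set.self_mem_Ici ht ht
  simp only [mul_zero, Real.exp_zero, one_mul, add_zero] at h
  have h6 : Real.exp (k * t) * ((1 + t) * f t - R - H) ≤ 0 := by
    have : 1 ≤ Real.exp (k * t) := Real.one_le_exp (by positivity)
    nlinarith
  have h7 := nonpos_of_mul_nonpos_right h6 (Real.exp_pos _)
  rw [add_mul, one_mul]
  linarith

section MixedDerivatives

variable {E : Type*} [NormedAddCommGroup E] [NormedSpace ℝ E] {U : ℝ → ℝ → E}

theorem hasDerivAt_snd_of_contDiff (hU : ContDiff ℝ (⊤ : ℕ∞) fun p : ℝ × ℝ => U p.1 p.2)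
    (t x : ℝ) :
    HasDerivAt (U t) (fderiv ℝ (fun p : ℝ × ℝ => U p.1 p.2) (t, x) (0, 1)) x :=
  ((hU.differentiable (by simp)) (t, x)).hasFDerivAt.comp_hasDerivAt x
    ((hasDerivAt_const x t).prodMk (hasDerivAt_id x))

theorem hasDerivAt_fst_of_contDiff (hU : ContDiff ℝ (⊤ : ℕ∞) fun p : ℝ × ℝ => U p.1 p.2)
    (t x : ℝ) :
    HasDerivAt (fun s => U s x) (fderiv ℝ (fun p : ℝ × ℝ => U p.1 p.2) (t, x) (1, 0)) t :=
  ((hU.differentiable (by simp)) (t, x)).hasFDerivAt.comp_hasDerivAt (f := fun s => (s, x)) t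
    ((hasDerivAt_id t).prodMk (hasDerivAt_const t x))

theorem pdx_eq_fderiv (hU : ContDiff ℝ (⊤ : ℕ∞) fun p : ℝ × ℝ => U p.1 p.2) (t x : ℝ) :
    pdx U t x = fderiv ℝ (fun p : ℝ × ℝ => U p.1 p.2) (t, x) (0, 1) :=
  (hasDerivAt_snd_of_contDiff hU t x).deriv

theorem hasDerivAt_pdx (hU : ContDiff ℝ (⊤ : ℕ∞) fun p : ℝ × ℝ => U p.1 p.2) (t x : ℝ) :
    HasDerivAt (U t) (pdx U t x) x :=
  (hasDerivAt_snd_of_contDiff hU t x).differentiableAt.hasDerivAt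

theorem contDiff_pdx (hU : ContDiff ℝ (⊤ : ℕ∞) fun p : ℝ × ℝ => U p.1 p.2) :
    ContDiff ℝ (⊤ : ℕ∞) fun p : ℝ × ℝ => pdx U p.1 p.2 := by
  simp_rw [pdx_eq_fderiv hU]
  exact (hU.fderiv_right (m := (⊤ : ℕ∞)) (by simp)).clm_apply contDiff_const

theorem deriv_fst_pdx (hU : ContDiff ℝ (⊤ : ℕ∞) fun p : ℝ × ℝ => U p.1 p.2) (t x : ℝ) :
    deriv (fun s => pdx U s x) t = deriv (fun y => deriv (fun s => U s y) t) x := by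
  have hd : Differentiable ℝ (fderiv ℝ fun p : ℝ × ℝ => U p.1 p.2) :=
    (hU.fderiv_right (m := (⊤ : ℕ∞)) (by simp)).differentiable (by simp)
  have h1 := ((hd (t, x)).hasFDerivAt.comp_hasDerivAt (f := fun s => (s, x)) t
    ((hasDerivAt_id t).prodMk (hasDerivAt_const t x))).clm_apply
    (hasDerivAt_const t ((0, 1) : ℝ × ℝ))
  have h2 := ((hd (t, x)).hasFDerivAt.comp_hasDerivAt (f := fun y => (t, y)) x
    ((hasDerivAt_const x t).prodMk (hasDerivAt_id x))).clm_apply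
    (hasDerivAt_const x ((1, 0) : ℝ × ℝ))
  have e1 : (fun s => pdx U s x) = fun s =>
    fderiv ℝ (fun p : ℝ × ℝ => U p.1 p.2) (s, x) (0, 1) := funext fun s => pdx_eq_fderiv hU s x
  have e2 : (fun y => deriv (fun s => U s y) t) = fun y =>
      fderiv ℝ (fun p : ℝ × ℝ => U p.1 p.2) (t, y) (1, 0) :=
    funext fun y => (hasDerivAt_fst_of_contDiff hU t y).deriv
  have hs := (hU.contDiffAt (x := (t, x))).isSymmSndFDerivAt
    (by simpa using WithTop.coe_le_coe.2 (le_top (a := (2 : ℕ∞)))) (1, 0) (0, 1)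
  rw [e1, e2]
  simp only [Function.comp_def, map_zero, add_zero] at h1 h2
  rw [h1.deriv, h2.deriv, hs]

end MixedDerivatives

namespace IsClassicalSolution

variable {n₁ n₂ : ℕ} {A : Matrix (Idx n₁ n₂) (Idx n₁ n₂) ℝ}
  {D : Matrix (Fin n₂) (Fin n₂) ℝ} {U : ℝ → ℝ → Idx n₁ n₂ → ℝ}

theorem quadDecay_of_iteratedDeriv (hU : IsClassicalSolution A D U) (m : ℕ)
    {V : ℝ → ℝ → Idx n₁ n₂ → ℝ} (hV : Continuous fun p : ℝ × ℝ => V p.1 p.2)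
    (h : ∀ t x, V t x = iteratedDeriv m (fun y => U t y) x) (i : Idx n₁ n₂) :
    QuadDecay fun t x => V t x i := by
  refine ⟨(continuous_apply i).comp hV, fun T => ?_⟩
  obtain ⟨C, hC⟩ := hU.decay 0 m T
  obtain ⟨C', hC'⟩ := hU.decay 2 m T
  refine ⟨C + C', fun t ht x => ?_⟩
  rw [← div_eq_mul_inv, le_div_iff₀ (by positivity)]
  have h0 := hC t ht x
  have h2 := hC' t ht x
  rw [← h, sq_abs] at h2
  rw [← h, pow_zero, one_mul] at h0
  have h1 : |V t x i| ≤ ‖V t x‖ := norm_le_pi_norm (V t x) i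
  nlinarith [sq_nonneg x]

theorem hasDerivAt_time (hU : IsClassicalSolution A D U) {t : ℝ} (ht : 0 ≤ t) (x : ℝ) :
    HasDerivAt (fun s => U s x) (-(A *ᵥ pdx U t x + Bmat D *ᵥ U t x)) t := by
  have h := (hasDerivAt_fst_of_contDiff hU.smooth t x).differentiableAt.hasDerivAt
  rwa [eq_neg_of_add_eq_zero_left ((add_assoc _ _ _).symm.trans (hU.eqn t x ht))] at h

theorem hasDerivAt_time_pdx (hU : IsClassicalSolution A D U) {t : ℝ} (ht : 0 ≤ t) (x : ℝ) :
    HasDerivAt (fun s => pdx U s x)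
      (-(A *ᵥ pdx (pdx U) t x + Bmat D *ᵥ pdx U t x)) t := by
  have h := (hasDerivAt_fst_of_contDiff (contDiff_pdx hU.smooth) t x).differentiableAt.hasDerivAt
  rw [deriv_fst_pdx hU.smooth,
    show (fun y => deriv (fun s => U s y) t) = fun y => -(A *ᵥ pdx U t y + Bmat D *ᵥ U t y)
      from funext fun y => (hU.hasDerivAt_time ht y).deriv] at h
  exact h.congr_deriv ((((hasDerivAt_pdx (contDiff_pdx hU.smooth) t x).matrix_mulVec A).add
    ((hasDerivAt_pdx hU.smooth t x).matrix_mulVec (Bmat D))).neg.deriv)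

end IsClassicalSolution

theorem KalmanCondition.eq_zero_of_eigenvector {n₁ n₂ : ℕ}
    {A B : Matrix (Idx n₁ n₂) (Idx n₁ n₂) ℝ}
    (hK : KalmanCondition A B) (v : Idx n₁ n₂ → ℝ) (μ : ℝ) (hA : A *ᵥ v = μ • v)
    (hB : B *ᵥ v = 0) : v = 0 := by
  have hpow : ∀ k : ℕ, A ^ k *ᵥ v = μ ^ k • v := fun k => by
    induction k with
    | zero => simp
    | succ k ih => rw [pow_succ, ← mulVec_mulVec, hA, mulVec_smul, ih, smul_smul, pow_succ']
  exact hK v fun k _ => by rw [← mulVec_mulVec, hpow, mulVec_smul, hB, smul_zero]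

section Bmat

variable {n₁ n₂ : ℕ} (D : Matrix (Fin n₂) (Fin n₂) ℝ) (u : Idx n₁ n₂ → ℝ)

theorem Bmat_mulVec : Bmat D *ᵥ u = Sum.elim (0 : Fin n₁ → ℝ) (D *ᵥ (u ∘ Sum.inr)) := by
  simp [Bmat, fromBlocks_mulVec]

theorem dotProduct_Bmat_mulVec :
    u ⬝ᵥ (Bmat D *ᵥ u) = (u ∘ Sum.inr) ⬝ᵥ (D *ᵥ (u ∘ Sum.inr)) := by
  simp [Bmat_mulVec, dotProduct]

theorem Bmat_mulVec_dotProduct_self :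
    (Bmat D *ᵥ u) ⬝ᵥ (Bmat D *ᵥ u) = (D *ᵥ (u ∘ Sum.inr)) ⬝ᵥ (D *ᵥ (u ∘ Sum.inr)) := by
  simp [Bmat_mulVec, dotProduct]

end Bmat

theorem Matrix.IsSymm.dotProduct_mulVec_comm {ι : Type*} [Fintype ι] {A : Matrix ι ι ℝ}
    (hA : A.IsSymm) (u v : ι → ℝ) : u ⬝ᵥ (A *ᵥ v) = v ⬝ᵥ (A *ᵥ u) := by
  rw [dotProduct_mulVec, ← mulVec_transpose, hA.eq, dotProduct_comm]

theorem dotProduct_mulVec_of_transpose_eq_neg {ι : Type*} [Fintype ι] {K : Matrix ι ι ℝ}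
    (hK : Kᵀ = -K) (u v : ι → ℝ) : u ⬝ᵥ (K *ᵥ v) = -(v ⬝ᵥ (K *ᵥ u)) := by
  rw [dotProduct_mulVec, ← mulVec_transpose, hK, neg_mulVec, neg_dotProduct, dotProduct_comm]

theorem sqL2_eq_integral_dotProduct {ι : Type*} [Fintype ι] (f : ℝ → ι → ℝ) :
    sqL2 f = ∫ x, f x ⬝ᵥ f x := by
  simp [sqL2, dotProduct, sq]

namespace IsClassicalSolution

variable {n₁ n₂ : ℕ} {A : Matrix (Idx n₁ n₂) (Idx n₁ n₂) ℝ}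
  {D : Matrix (Fin n₂) (Fin n₂) ℝ} {U : ℝ → ℝ → Idx n₁ n₂ → ℝ}

theorem quadDecay (hU : IsClassicalSolution A D U) (i : Idx n₁ n₂) :
    QuadDecay fun t x => U t x i :=
  hU.quadDecay_of_iteratedDeriv 0 hU.smooth.continuous (by simp) i

theorem quadDecay_pdx (hU : IsClassicalSolution A D U) (i : Idx n₁ n₂) :
    QuadDecay fun t x => pdx U t x i :=
  hU.quadDecay_of_iteratedDeriv 1 (contDiff_pdx hU.smooth).continuous (by simp [pdx]) i

theorem quadDecay_pdx_pdx (hU : IsClassicalSolution A D U) (i : Idx n₁ n₂) :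
    QuadDecay fun t x => pdx (pdx U) t x i :=
  hU.quadDecay_of_iteratedDeriv 2 (contDiff_pdx (contDiff_pdx hU.smooth)).continuous
    (by intros; rw [iteratedDeriv_succ, iteratedDeriv_one]; rfl) i

theorem quadDecay_time (hU : IsClassicalSolution A D U) (i : Idx n₁ n₂) :
    QuadDecay fun t x => (-(A *ᵥ pdx U t x + Bmat D *ᵥ U t x)) i :=
  ((QuadDecay.mulVec A hU.quadDecay_pdx i).add (QuadDecay.mulVec (Bmat D) hU.quadDecay i)).neg

theorem quadDecay_time_pdx (hU : IsClassicalSolution A D U) (i : Idx n₁ n₂) :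
    QuadDecay fun t x => (-(A *ᵥ pdx (pdx U) t x + Bmat D *ᵥ pdx U t x)) i :=
  ((QuadDecay.mulVec A hU.quadDecay_pdx_pdx i).add
    (QuadDecay.mulVec (Bmat D) hU.quadDecay_pdx i)).neg

/-- The corrected `H¹` energy dissipates `‖∂ₓU‖²`. -/
theorem exists_hasDerivAt_lyapunov_le (hU : IsClassicalSolution A D U) (hA : A.IsSymm)
    {K : Matrix (Idx n₁ n₂) (Idx n₁ n₂) ℝ} (hK : Kᵀ = -K) {c : ℝ}
    (hKc : ∀ u v, -2 * (u ⬝ᵥ (Bmat D *ᵥ u)) - 2 * (v ⬝ᵥ (Bmat D *ᵥ v))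
        - 2 * (v ⬝ᵥ (K *ᵥ (A *ᵥ v + Bmat D *ᵥ u))) ≤ -c * (v ⬝ᵥ v)) {t : ℝ} (ht : 0 < t) :
    ∃ m ≤ -c * ∫ x, pdx U t x ⬝ᵥ pdx U t x,
      HasDerivAt (fun s => ∫ x, (U s x ⬝ᵥ U s x + pdx U s x ⬝ᵥ pdx U s x
        + pdx U s x ⬝ᵥ (K *ᵥ U s x))) m t := by
  have hu := hU.quadDecay
  have hv := hU.quadDecay_pdx
  have hw := hU.quadDecay_pdx_pdx
  have hut := hU.quadDecay_time
  have hvt := hU.quadDecay_time_pdx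
  have hux := hasDerivAt_pdx hU.smooth
  have hvx := hasDerivAt_pdx (contDiff_pdx hU.smooth)
  rw [← integral_const_mul]
  refine QuadDecay.exists_hasDerivAt_integral_le
    (((QuadDecay.dotProduct hu hu).add (.dotProduct hv hv)).add
      (.dotProduct hv (QuadDecay.mulVec K hu)))
    ((((QuadDecay.dotProduct hut hu).add (.dotProduct hu hut)).add
      ((QuadDecay.dotProduct hvt hv).add (.dotProduct hv hvt))).add
      ((QuadDecay.dotProduct hvt (QuadDecay.mulVec K hu)).add
        (.dotProduct hv (QuadDecay.mulVec K hut))))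
    (((QuadDecay.dotProduct hu (QuadDecay.mulVec A hu)).neg.sub
      (.dotProduct hv (QuadDecay.mulVec A hv))).add (.dotProduct hut (QuadDecay.mulVec K hu)))
    ((((QuadDecay.dotProduct hv (QuadDecay.mulVec A hu)).add
      (.dotProduct hu (QuadDecay.mulVec A hv))).neg.sub
      ((QuadDecay.dotProduct hw (QuadDecay.mulVec A hv)).add
        (.dotProduct hv (QuadDecay.mulVec A hw)))).add
      ((QuadDecay.dotProduct hvt (QuadDecay.mulVec K hu)).add
        (.dotProduct hut (QuadDecay.mulVec K hv))))
    ((QuadDecay.dotProduct hv hv).const_mul (-c)) (fun s x hs => ?_) (fun s x _ => ?_)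
    (fun s x _ => ?_) ht
  · have h1 := hU.hasDerivAt_time hs.le x
    have h2 := hU.hasDerivAt_time_pdx hs.le x
    exact ((h1.dotProduct h1).add (h2.dotProduct h2)).add (h2.dotProduct (h1.matrix_mulVec K))
  · have h1 := hux s x
    have h2 := hvx s x
    exact (((h1.dotProduct (h1.matrix_mulVec A)).neg.sub (h2.dotProduct (h2.matrix_mulVec A))).add
      (((h2.matrix_mulVec A).add (h1.matrix_mulVec (Bmat D))).neg.dotProduct
        (h1.matrix_mulVec K)))
  · have h := hKc (U s x) (pdx U s x)
    generalize U s x = u at *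
    generalize pdx (pdx U) s x = w at *
    generalize pdx U s x = v at *
    have e1 := hA.dotProduct_mulVec_comm u v
    have e2 := hA.dotProduct_mulVec_comm w v
    have e3 := dotProduct_mulVec_of_transpose_eq_neg hK (-(A *ᵥ v + Bmat D *ᵥ u)) v
    rw [e3]
    simp only [mulVec_neg, dotProduct_neg, dotProduct_comm _ u, dotProduct_comm _ v,
      dotProduct_add] at h ⊢
    linarith

theorem exists_hasDerivAt_pdx_energy_le (hU : IsClassicalSolution A D U) (hA : A.IsSymm)
    (hD : ∀ u : Idx n₁ n₂ → ℝ, 0 ≤ u ⬝ᵥ (Bmat D *ᵥ u)) {t : ℝ} (ht : 0 < t) :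
    ∃ m ≤ 0, HasDerivAt (fun s => ∫ x, pdx U s x ⬝ᵥ pdx U s x) m t := by
  have hv := hU.quadDecay_pdx
  have hw := hU.quadDecay_pdx_pdx
  have hvt := hU.quadDecay_time_pdx
  have hvx := hasDerivAt_pdx (contDiff_pdx hU.smooth)
  rw [← integral_zero ℝ ℝ]
  refine QuadDecay.exists_hasDerivAt_integral_le (QuadDecay.dotProduct hv hv)
    ((QuadDecay.dotProduct hvt hv).add (.dotProduct hv hvt))
    (QuadDecay.dotProduct hv (QuadDecay.mulVec A hv)).neg
    ((QuadDecay.dotProduct hw (QuadDecay.mulVec A hv)).add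
        (.dotProduct hv (QuadDecay.mulVec A hw))).neg
    QuadDecay.zero (fun s x hs => ?_) (fun s x _ => ?_) (fun s x _ => ?_) ht
  · have h2 := hU.hasDerivAt_time_pdx hs.le x
    exact h2.dotProduct h2
  · exact ((hvx s x).dotProduct ((hvx s x).matrix_mulVec A)).neg
  · have h := hD (pdx U s x)
    generalize pdx (pdx U) s x = w at *
    generalize pdx U s x = v at *
    have e2 := hA.dotProduct_mulVec_comm w v
    simp only [dotProduct_neg, dotProduct_comm _ v, dotProduct_add] at h ⊢
    linarith

theorem exists_hasDerivAt_dissipated_energy_le (hU : IsClassicalSolution A D U) {κ a : ℝ}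
    (hκ : 0 < κ) (hD : ∀ X, κ * (X ⬝ᵥ X) ≤ X ⬝ᵥ (D *ᵥ X))
    (ha : ∀ v, (A.submatrix Sum.inr id *ᵥ v) ⬝ᵥ (A.submatrix Sum.inr id *ᵥ v) ≤ a * (v ⬝ᵥ v))
    {t : ℝ} (ht : 0 < t) :
    ∃ m ≤ -κ * (∫ x, U2part U t x ⬝ᵥ U2part U t x)
        + κ⁻¹ * a * ∫ x, pdx U t x ⬝ᵥ pdx U t x,
      HasDerivAt (fun s => ∫ x, U2part U s x ⬝ᵥ U2part U s x) m t := by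
  have hu : ∀ j, QuadDecay fun t x => U2part U t x j := fun j => hU.quadDecay (Sum.inr j)
  have hv := hU.quadDecay_pdx
  have hut : ∀ j : Fin n₂, QuadDecay fun t x =>
      ((-(A *ᵥ pdx U t x + Bmat D *ᵥ U t x)) ∘ Sum.inr) j :=
    fun j => hU.quadDecay_time (Sum.inr j)
  have huu := QuadDecay.dotProduct hu hu
  have hvv := QuadDecay.dotProduct hv hv
  rw [← integral_const_mul, ← integral_const_mul,
    ← integral_add ((huu.const_mul _).integrable ht.le) ((hvv.const_mul _).integrable ht.le)]
  refine QuadDecay.exists_hasDerivAt_integral_le huu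
    ((QuadDecay.dotProduct hut hu).add (.dotProduct hu hut)) QuadDecay.zero QuadDecay.zero
    ((huu.const_mul _).add (hvv.const_mul _)) (fun s x hs => ?_)
    (fun s x _ => hasDerivAt_const x 0) (fun s x _ => ?_) ht
  · have h : HasDerivAt (fun s => U2part U s x)
        ((-(A *ᵥ pdx U s x + Bmat D *ᵥ U s x)) ∘ Sum.inr) s :=
      hasDerivAt_pi.2 fun j => hasDerivAt_pi.1 (hU.hasDerivAt_time hs.le x) (Sum.inr j)
    exact h.dotProduct h
  · have e : (-(A *ᵥ pdx U s x + Bmat D *ᵥ U s x)) ∘ Sum.inr =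
        -(A.submatrix Sum.inr id *ᵥ pdx U s x) - D *ᵥ U2part U s x := by
      rw [Bmat_mulVec]
      ext j
      simp [mulVec, dotProduct, U2part, Function.comp_def, sub_eq_add_neg, add_comm]
    rw [e]
    have h1 := ha (pdx U s x)
    have h2 := hD (U2part U s x)
    have h3 := two_mul_dotProduct_le (-(A.submatrix Sum.inr id *ᵥ pdx U s x)) (U2part U s x) hκ
    have h4 := mul_le_mul_of_nonneg_left h1 (inv_pos.2 hκ).le
    generalize A.submatrix Sum.inr id *ᵥ pdx U s x = p at *
    simp only [neg_dotProduct, dotProduct_neg, dotProduct_sub, neg_neg,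
      dotProduct_comm _ (U2part U s x)] at h3 ⊢
    linarith

end IsClassicalSolution

/-- **Theorem 1.** Natural decay without Fourier analysis: under the
Kalman rank condition there is `C > 0` (depending only on `n, A, B, κ`) such that every
classical solution satisfies
`‖U₂(t)‖_{L²} + ‖∂ₓU(t)‖_{L²} ≤ C (1+t)^{−1/2} ‖U₀‖_{H¹}` for all `t > 0`. -/
theorem natural_decay
    {n₁ n₂ : ℕ} (hn₁ : 1 ≤ n₁) (hn₂ : 1 ≤ n₂)
    (A : Matrix (Idx n₁ n₂) (Idx n₁ n₂) ℝ) (hA : A.IsSymm)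
    (D : Matrix (Fin n₂) (Fin n₂) ℝ) (hD : D.IsSymm) (hDpos : D.PosDef)
    (κ : ℝ) (hκ : 0 < κ)
    (hdiss : ∀ X : Fin n₂ → ℝ, κ * ∑ j, (X j) ^ 2 ≤ ∑ j, D.mulVec X j * X j)
    (hK : KalmanCondition A (Bmat D)) :
    ∃ C : ℝ, 0 < C ∧
      ∀ U : ℝ → ℝ → Idx n₁ n₂ → ℝ, IsClassicalSolution A D U →
        ∀ t : ℝ, 0 < t →
          Real.sqrt (sqL2 (U2part U t)) + Real.sqrt (sqL2 (fun x => pdx U t x)) ≤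
            C * (1 + t) ^ (-(1 / 2) : ℝ) * Real.sqrt (sqH1 (U 0)) := by
  have hD' : ∀ X, κ * (X ⬝ᵥ X) ≤ X ⬝ᵥ (D *ᵥ X) := fun X => by
    rw [dotProduct_comm X (D *ᵥ X)]
    simpa [dotProduct, sq] using hdiss X
  obtain ⟨d, hd, hdD⟩ := exists_mulVec_dotProduct_self_le D
  have hB : ∀ u : Idx n₁ n₂ → ℝ, κ / d * ((Bmat D *ᵥ u) ⬝ᵥ (Bmat D *ᵥ u)) ≤
      u ⬝ᵥ (Bmat D *ᵥ u) := fun u => by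
    rw [Bmat_mulVec_dotProduct_self, dotProduct_Bmat_mulVec]
    refine le_trans ?_ (hD' _)
    calc κ / d * ((D *ᵥ (u ∘ Sum.inr)) ⬝ᵥ (D *ᵥ (u ∘ Sum.inr)))
        ≤ κ / d * (d * ((u ∘ Sum.inr) ⬝ᵥ (u ∘ Sum.inr))) := by gcongr; exact hdD _
      _ = _ := by field_simp
  have hBnn : ∀ u : Idx n₁ n₂ → ℝ, 0 ≤ u ⬝ᵥ (Bmat D *ᵥ u) := fun u =>
    (mul_nonneg (by positivity) (dotProduct_self_nonneg_real _)).trans (hB u)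
  obtain ⟨K, c, hKs, hc, hKle, hKc⟩ := exists_lyapunov_corrector A (Bmat D) hA
    hK.eq_zero_of_eigenvector (by positivity : 0 < κ / d) hB
  obtain ⟨a, ha, haA⟩ := exists_mulVec_dotProduct_self_le
    (A.submatrix (Sum.inr : Fin n₂ → Idx n₁ n₂) id)
  set C₁ := 1 + 2 / c with hC₁
  set C₂ := 1 + (4 + κ⁻¹ * a * C₁) / κ with hC₂
  refine ⟨√C₂ + √C₁, by positivity, fun U hU t ht => ?_⟩
  have huu := QuadDecay.dotProduct hU.quadDecay hU.quadDecay
  have hvv := QuadDecay.dotProduct hU.quadDecay_pdx hU.quadDecay_pdx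
  have hu2 : QuadDecay fun t x => U2part U t x ⬝ᵥ U2part U t x :=
    QuadDecay.dotProduct (fun j => hU.quadDecay (Sum.inr j)) fun j => hU.quadDecay (Sum.inr j)
  have hΦ := (huu.add hvv).add (QuadDecay.dotProduct hU.quadDecay_pdx
    (QuadDecay.mulVec K hU.quadDecay))
  have hu2le : ∀ t x, U2part U t x ⬝ᵥ U2part U t x ≤ U t x ⬝ᵥ U t x := fun t x => by
    simp only [dotProduct, U2part, Fintype.sum_sum_type]
    exact le_add_of_nonneg_left (sum_nonneg fun i _ => mul_self_nonneg _)
  have hH : sqH1 (U 0) = ∫ x, (U 0 x ⬝ᵥ U 0 x + pdx U 0 x ⬝ᵥ pdx U 0 x) := by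
    rw [integral_add (huu.integrable le_rfl) (hvv.integrable le_rfl), sqH1,
      sqL2_eq_integral_dotProduct, sqL2_eq_integral_dotProduct]
    rfl
  have hHi := (huu.add hvv).integrable le_rfl
  obtain ⟨hE, hf⟩ := decay_of_lyapunov (H := sqH1 (U 0)) hc hκ (by positivity : 0 < κ⁻¹ * a)
    hΦ.continuousOn_integral hvv.continuousOn_integral hu2.continuousOn_integral
    (by
      rw [hH, ← integral_const_mul]
      refine integral_mono (hΦ.integrable le_rfl) (hHi.const_mul 2) fun x => ?_
      have h1 := abs_le.1 (hKle (U 0 x) (pdx U 0 x))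
      have h2 := dotProduct_self_nonneg_real (U 0 x)
      have h3 := dotProduct_self_nonneg_real (pdx U 0 x)
      dsimp only
      linarith)
    (by
      rw [hH]
      exact integral_mono (hvv.integrable le_rfl) hHi fun x =>
        le_add_of_nonneg_left (dotProduct_self_nonneg_real _))
    (by
      rw [hH]
      exact integral_mono (hu2.integrable le_rfl) hHi fun x =>
        le_add_of_le_of_nonneg (hu2le 0 x) (dotProduct_self_nonneg_real _))
    (fun s _ => integral_nonneg fun x => dotProduct_self_nonneg_real _)
    (fun s _ => integral_nonneg fun x => dotProduct_self_nonneg_real _)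
    (fun s hs => by
      rw [← integral_const_mul]
      refine integral_mono (hu2.integrable hs) ((hΦ.integrable hs).const_mul 2) fun x => ?_
      have h1 := abs_le.1 (hKle (U s x) (pdx U s x))
      have h3 := dotProduct_self_nonneg_real (pdx U s x)
      have h4 := hu2le s x
      dsimp only
      linarith)
    (fun s hs => hU.exists_hasDerivAt_lyapunov_le hA hKs hKc hs)
    (fun s hs => hU.exists_hasDerivAt_pdx_energy_le hA hBnn hs)
    (fun s hs => hU.exists_hasDerivAt_dissipated_energy_le hκ hD' haA hs) ht.le
  have hsqrt : ∀ {q C : ℝ}, 0 ≤ C → (1 + t) * q ≤ C * sqH1 (U 0) →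
      √q ≤ √C * (1 + t) ^ (-(1 / 2) : ℝ) * √(sqH1 (U 0)) := fun {q C} hC h => by
    have h1t : 0 < 1 + t := by linarith
    rw [Real.rpow_neg h1t.le, ← Real.sqrt_eq_rpow, ← Real.sqrt_inv, ← Real.sqrt_mul hC,
      ← Real.sqrt_mul (by positivity)]
    refine Real.sqrt_le_sqrt ?_
    rw [mul_right_comm, ← div_eq_mul_inv, le_div_iff₀ h1t]
    linarith
  rw [sqL2_eq_integral_dotProduct, sqL2_eq_integral_dotProduct, add_mul, add_mul]
  exact add_le_add (hsqrt (by positivity) hf) (hsqrt (by positivity) hE)
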